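/- Let p be a prime and G a finite group. Then G has property L_p if and only if every subgroup of G has property L_p. -/

import Mathlib

/-- The natural reduction ring homomorphism `W₂(k) → k` from length-two `p`-typical
Witt vectors to `k`, given by the zeroth coefficient. -/
noncomputable def wittReduce (p : ℕ) [Fact p.Prime] (k : Type*) [CommRing k] :
    TruncatedWittVector p 2 k →+* k :=
  RingHom.liftOfRightInverse (WittVector.truncate 2) TruncatedWittVector.out
    TruncatedWittVector.truncateFun_out
    ⟨WittVector.constantCoeff, fun x hx => by
      rw [WittVector.mem_ker_truncate] at hx
      simpa [RingHom.mem_ker] using hx 0 (by norm_num)⟩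

/-- A finite group `G` has property `L_p` if every homomorphism `G → GL_n(k)`, for `k` a
finite field of characteristic `p`, lifts to `GL_n(W₂(k))`. -/
def HasLp (p : ℕ) [Fact p.Prime] (G : Type*) [Group G] : Prop :=
  ∀ (n : ℕ), 1 ≤ n → ∀ (k : Type) [Field k] [Fintype k] [CharP k p],
    ∀ f : G →* GL (Fin n) k,
      ∃ g : G →* GL (Fin n) (TruncatedWittVector p 2 k),
        (Matrix.GeneralLinearGroup.map (wittReduce p k)).comp g = f

/-- A group has property `L` if it has property `L_p` for every prime `p`. -/
def HasL (G : Type*) [Group G] : Prop :=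
  ∀ (p : ℕ) [Fact p.Prime], HasLp p G

theorem wittReduce_truncate (p : ℕ) [Fact p.Prime] {k : Type*} [CommRing k]
    (x : WittVector p k) : wittReduce p k (WittVector.truncate 2 x) = x.coeff 0 :=
  RingHom.liftOfRightInverse_comp_apply (WittVector.truncate 2) TruncatedWittVector.out
    TruncatedWittVector.truncateFun_out _ x

/-- In characteristic `p`, the kernel of `W₂(k) → k` has square zero. -/
theorem mul_eq_zero_of_wittReduce_eq_zero (p : ℕ) [Fact p.Prime] {k : Type*} [CommRing k]
    [CharP k p] {a b : TruncatedWittVector p 2 k} (ha : wittReduce p k a = 0)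
    (hb : wittReduce p k b = 0) : a * b = 0 := by
  obtain ⟨x, rfl⟩ := WittVector.truncate_surjective p 2 k a
  obtain ⟨y, rfl⟩ := WittVector.truncate_surjective p 2 k b
  rw [wittReduce_truncate] at ha hb
  have hshift (z : WittVector p k) (hz : z.coeff 0 = 0) :
      WittVector.verschiebung (z.shift 1) = z := by
    rw [WittVector.verschiebung_shift z 0 (by simpa using hz)]
    ext i
    rw [WittVector.shift_coeff, zero_add]
  rw [← map_mul, ← RingHom.mem_ker, WittVector.mem_ker_truncate, ← hshift x ha, ← hshift y hb]
  intro i hi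
  have h := WittVector.iterate_verschiebung_mul (x.shift 1) (y.shift 1) 1 1
  simp only [Function.iterate_one] at h
  rw [h]
  exact WittVector.iterate_verschiebung_coeff_eq_zero _ hi

/-- If a matrix representation is block diagonal modulo an ideal of square zero, then its
diagonal blocks are again representations. -/
def MonoidHom.diagonalBlock {H R S n N : Type*} [Group H] [CommRing R] [CommRing S]
    [Fintype n] [DecidableEq n] [Fintype N] [DecidableEq N] (φ : R →+* S)
    (hφ : ∀ a b, φ a = 0 → φ b = 0 → a * b = 0) (M : H →* Matrix N N R) (ι : n ↪ N)
    (hr : ∀ h i, ∀ x ∉ Set.range ι, φ (M h (ι i) x) = 0)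
    (hc : ∀ h i, ∀ x ∉ Set.range ι, φ (M h x (ι i)) = 0) : H →* Matrix n n R where
  toFun h := (M h).submatrix ι ι
  map_one' := by rw [map_one, Matrix.submatrix_one_embedding]
  map_mul' a b := by
    ext i j
    rw [map_mul, Matrix.submatrix_apply, Matrix.mul_apply, Matrix.mul_apply]
    refine (Fintype.sum_of_injective ι ι.injective _ _ (fun x hx => ?_) fun _ => rfl).symm
    exact hφ _ _ (hr a i x hx) (hc b j x hx)

open Classical in
/-- The extension by zero to `G` of a monoid homomorphism defined on a subgroup `H`. -/
noncomputable def MonoidHom.extendByZero {G A : Type*} [Group G] {H : Subgroup G}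
    [MonoidWithZero A] (f : H →* A) (g : G) : A :=
  if h : g ∈ H then f ⟨g, h⟩ else 0

namespace MonoidHom

variable {G A : Type*} [Group G] {H : Subgroup G}

section ExtendByZero

variable [MonoidWithZero A] (f : H →* A)

theorem extendByZero_coe (h : H) : f.extendByZero (h : G) = f h :=
  dif_pos h.2

theorem extendByZero_of_notMem {g : G} (hg : g ∉ H) : f.extendByZero g = 0 :=
  dif_neg hg

theorem extendByZero_mul {a b : G} (ha : a ∈ H) :
    f.extendByZero (a * b) = f.extendByZero a * f.extendByZero b := by
  by_cases hb : b ∈ H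
  · lift a to H using ha
    lift b to H using hb
    rw [← Subgroup.coe_mul]
    simp only [extendByZero_coe, map_mul]
  · rw [extendByZero_of_notMem f hb, mul_zero,
      extendByZero_of_notMem f (by rwa [H.mul_mem_cancel_left ha])]

end ExtendByZero

theorem inv_section_mul_mem_iff {s : G ⧸ H → G} (hs : ∀ q, (s q : G ⧸ H) = q) (g : G)
    (x y : G ⧸ H) : (s x)⁻¹ * (g * s y) ∈ H ↔ x = g • y := by
  rw [← QuotientGroup.eq, hs, ← smul_eq_mul, ← MulAction.Quotient.smul_coe, hs]

/-- The block matrix representation of `G` induced from a representation `f` of `H`, with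
respect to a section `s` of `G → G ⧸ H`. -/
noncomputable def inducedMatrix [Ring A] [Fintype (G ⧸ H)] [DecidableEq (G ⧸ H)] (f : H →* A)
    (s : G ⧸ H → G) (hs : ∀ q, (s q : G ⧸ H) = q) : G →* Matrix (G ⧸ H) (G ⧸ H) A where
  toFun g := Matrix.of fun x y => f.extendByZero ((s x)⁻¹ * (g * s y))
  map_one' := by
    ext x y
    rw [Matrix.of_apply]
    rcases eq_or_ne x y with rfl | hxy
    · rw [one_mul, inv_mul_cancel, Matrix.one_apply_eq, ← Subgroup.coe_one H, extendByZero_coe,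
        map_one]
    · rw [Matrix.one_apply_ne hxy, extendByZero_of_notMem]
      rwa [inv_section_mul_mem_iff hs, one_smul]
  map_mul' a b := by
    ext x z
    rw [Matrix.mul_apply, Finset.sum_eq_single (a⁻¹ • x)]
    · simp only [Matrix.of_apply]
      rw [← extendByZero_mul]
      · congr 1
        group
      · rw [inv_section_mul_mem_iff hs, smul_inv_smul]
    · intro y _ hy
      rw [Matrix.of_apply, extendByZero_of_notMem, zero_mul]
      rwa [inv_section_mul_mem_iff hs, ← inv_smul_eq_iff, eq_comm]
    · simp

end MonoidHom

theorem HasLp.of_mulEquiv {p : ℕ} [Fact p.Prime] {G G' : Type*} [Group G] [Group G']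
    (e : G ≃* G') (hG : HasLp p G) : HasLp p G' := by
  intro n hn k _ _ _ f
  obtain ⟨g, hg⟩ := hG n hn k (f.comp e.toMonoidHom)
  refine ⟨g.comp e.symm.toMonoidHom, ?_⟩
  rw [← MonoidHom.comp_assoc, hg]
  ext1 x
  simp

/-- Property `L_p` allows lifting representations indexed by an arbitrary finite type. -/
theorem HasLp.exists_lift {p : ℕ} [Fact p.Prime] {G : Type*} [Group G] (hG : HasLp p G)
    {N : Type*} [Fintype N] [DecidableEq N] [Nonempty N] {k : Type} [Field k] [Fintype k]
    [CharP k p] (f : G →* Matrix N N k) :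
    ∃ g : G →* Matrix N N (TruncatedWittVector p 2 k),
      ∀ x, (wittReduce p k).mapMatrix (g x) = f x := by
  let e := Fintype.equivFin N
  let E (R : Type) [CommRing R] := Matrix.reindexRingEquiv R e
  obtain ⟨g, hg⟩ := hG (Fintype.card N) Fintype.card_pos k
    ((E k).toRingHom.toMonoidHom.comp f).toHomUnits
  refine ⟨(E (TruncatedWittVector p 2 k)).symm.toRingHom.toMonoidHom.comp
    ((Units.coeHom _).comp g), fun x => ?_⟩
  ext i j
  have h := congrArg (fun u : GL (Fin (Fintype.card N)) k => u.val (e i) (e j))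
    (DFunLike.congr_fun hg x)
  simpa [E] using h

theorem HasLp.subgroup {p : ℕ} [Fact p.Prime] {G : Type*} [Group G] [Finite G]
    (hG : HasLp p G) (H : Subgroup G) : HasLp p H := by
  classical
  intro n hn k _ _ _ f
  have : Nonempty (Fin n) := ⟨⟨0, hn⟩⟩
  have : Fintype (G ⧸ H) := Fintype.ofFinite _
  let q₀ : G ⧸ H := ((1 : G) : G ⧸ H)
  let s : G ⧸ H → G := Function.update Quotient.out q₀ 1
  have hs₀ : s q₀ = 1 := Function.update_self ..
  have hs (q : G ⧸ H) : (s q : G ⧸ H) = q := by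
    rcases eq_or_ne q q₀ with rfl | hq
    · rw [hs₀]
    · rw [show s q = q.out from Function.update_of_ne hq ..]
      exact Quotient.out_eq' q
  let F : H →* Matrix (Fin n) (Fin n) k := (Units.coeHom _).comp f
  let I := F.inducedMatrix s hs
  obtain ⟨g, hg⟩ := hG.exists_lift
    ((Matrix.compRingEquiv (G ⧸ H) (Fin n) k).toRingHom.toMonoidHom.comp I)
  have hgI (a : G) (x y : G ⧸ H) (i j : Fin n) :
      wittReduce p k (g a (x, i) (y, j)) = F.extendByZero ((s x)⁻¹ * (a * s y)) i j :=
    congrFun (congrFun (hg a) (x, i)) (y, j)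
  have hfix (h : H) : (h : G) • q₀ = q₀ := by
    rw [MulAction.Quotient.smul_coe, QuotientGroup.eq]
    simp
  have hzero (h : H) (x y : G ⧸ H) (i j : Fin n) (hxy : x ≠ (h : G) • y) :
      wittReduce p k (g h (x, i) (y, j)) = 0 := by
    rw [hgI, MonoidHom.extendByZero_of_notMem, Matrix.zero_apply]
    rwa [MonoidHom.inv_section_mul_mem_iff hs]
  let ι : Fin n ↪ (G ⧸ H) × Fin n := ⟨Prod.mk q₀, Prod.mk_right_injective q₀⟩
  have hι {x : G ⧸ H} {i : Fin n} (h : (x, i) ∉ Set.range ι) : x ≠ q₀ := by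
    rintro rfl
    exact h ⟨i, rfl⟩
  refine ⟨((g.comp H.subtype).diagonalBlock (wittReduce p k)
    (fun _ _ => mul_eq_zero_of_wittReduce_eq_zero p) ι ?_ ?_).toHomUnits, ?_⟩
  · rintro h i ⟨x, j⟩ hx
    refine hzero h _ _ _ _ fun hq => hι hx ?_
    rw [← smul_left_cancel_iff (h : G), hfix, ← hq]
  · rintro h i ⟨x, j⟩ hx
    exact hzero h _ _ _ _ (by rw [hfix]; exact hι hx)
  · ext h i j
    refine (hgI h q₀ q₀ i j).trans ?_
    rw [hs₀, inv_one, one_mul, mul_one, MonoidHom.extendByZero_coe]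
    rfl

/-- `G` has property `L_p` iff every subgroup of `G` has property `L_p`. -/
theorem hasLp_iff_forall_subgroup (p : ℕ) [Fact p.Prime] (G : Type*) [Group G] [Finite G] :
    HasLp p G ↔ ∀ H : Subgroup G, HasLp p ↥H :=
  ⟨fun hG H => hG.subgroup H, fun h => (h ⊤).of_mulEquiv Subgroup.topEquiv⟩
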